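/- Let T be a rooted tree on n nodes and let T̃ be the tree obtained from T by subdividing every edge (so T̃ has 2n − 1 nodes). Then for every positive integer k, H_k(T̃) ≤ 2·H_k(T) + 2k. -/

import Mathlib

/-- A rooted tree on a node set `α`, given by its root and parent function
(the root is its own parent, and every node reaches the root by iterating `parent`). -/
structure RTree (α : Type*) where
  root : α
  parent : α → α
  parent_root : parent root = root
  reaches_root : ∀ v, ∃ k, parent^[k] v = root

namespace RTree

variable {α : Type*}

/-- `u` is a (weak) ancestor of `v` in `T`. -/
def ancestor (T : RTree α) (u v : α) : Prop := ∃ k, T.parent^[k] v = u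

/-- `u` is a proper ancestor of `v` in `T`. -/
def properAncestor (T : RTree α) (u v : α) : Prop := T.ancestor u v ∧ u ≠ v

/-- The node set of the subtree `T_v` of `T` rooted at `v`,
i.e. `v` together with all of its descendants. -/
def subtree (T : RTree α) (v : α) : Set α := {u | T.ancestor v u}

/-- A leaf of `T` is a node with no children. -/
def IsLeaf (T : RTree α) (v : α) : Prop := ∀ u, T.parent u = v → u = v

end RTree

/-- For `S ⊆ V(T)`, `H_S(T) = Σ_{v ∈ S} log₂(|S| / |V(T_v) ∩ S|)`. -/
noncomputable def entS {α : Type*} (T : RTree α) (S : Finset α) : ℝ :=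
  ∑ v ∈ S, Real.logb 2 ((S.card : ℝ) / ((T.subtree v ∩ ↑S).ncard : ℝ))

/-- For a positive integer `k`, `H_k(T) = max{ H_S(T) : S ⊆ V(T), |S| ≤ k }`. -/
noncomputable def entK {α : Type*} [Fintype α] (T : RTree α) (k : ℕ) : ℝ :=
  (Finset.filter (fun S => S.card ≤ k) (Finset.univ : Finset α).powerset).sup'
    ⟨∅, by simp⟩ (entS T)

/-- `S` is closed under taking descendants in `T`. -/
def DescClosed {α : Type*} (T : RTree α) (S : Finset α) : Prop :=
  ∀ v ∈ S, ∀ u ∈ T.subtree v, u ∈ S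

namespace RTree

theorem ancestor_refl {α : Type*} (T : RTree α) (v : α) : T.ancestor v v := ⟨0, rfl⟩

theorem ancestor_trans {α : Type*} (T : RTree α) {u v w : α}
    (huv : T.ancestor u v) (hvw : T.ancestor v w) : T.ancestor u w := by
  obtain ⟨i, rfl⟩ := huv
  obtain ⟨j, rfl⟩ := hvw
  exact ⟨i + j, Function.iterate_add_apply _ _ _ _⟩

theorem ancestor_parent {α : Type*} (T : RTree α) (v : α) : T.ancestor (T.parent v) v := ⟨1, rfl⟩

/-- A proper ancestor of `v` is an ancestor of the parent of `v`. -/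
theorem ancestor_parent_of_ne {α : Type*} (T : RTree α) {u v : α}
    (h : T.ancestor u v) (hne : u ≠ v) : T.ancestor u (T.parent v) := by
  obtain ⟨_ | j, hj⟩ := h
  · exact absurd hj.symm hne
  · exact ⟨j, hj⟩

/-- Subdividing edges preserves ancestry between original nodes. -/
theorem ancestor_subdivision {α β : Type*} {T : RTree α} {T' : RTree β} {f g : α → β}
    (hpf : ∀ v : α, v ≠ T.root → T'.parent (f v) = g v)
    (hpg : ∀ v : α, v ≠ T.root → T'.parent (g v) = f (T.parent v))
    {u v : α} (h : T.ancestor u v) : T'.ancestor (f u) (f v) := by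
  obtain ⟨j, hj⟩ := h
  induction j generalizing v with
  | zero => obtain rfl : v = u := hj; exact T'.ancestor_refl _
  | succ j ih =>
    have hp := ih hj
    by_cases hv : v = T.root
    · rwa [hv, T.parent_root, ← hv] at hp
    · rw [← hpg v hv, ← hpf v hv] at hp
      exact T'.ancestor_trans hp
        (T'.ancestor_trans (T'.ancestor_parent _) (T'.ancestor_parent _))

end RTree

theorem ncard_subtree_inter_pos {α : Type*} (T : RTree α) {S : Finset α} {v : α} (hv : v ∈ S) :
    0 < (T.subtree v ∩ ↑S).ncard :=
  (Set.ncard_pos (S.finite_toSet.subset Set.inter_subset_right)).2 ⟨v, T.ancestor_refl v, hv⟩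

theorem ncard_subtree_inter_le {α : Type*} (T : RTree α) (S : Finset α) (v : α) :
    (T.subtree v ∩ ↑S).ncard ≤ S.card := by
  rw [← Set.ncard_coe_finset S]
  exact Set.ncard_le_ncard Set.inter_subset_right S.finite_toSet

theorem entS_le_entK {α : Type*} [Fintype α] (T : RTree α) {S : Finset α} {k : ℕ}
    (h : S.card ≤ k) : entS T S ≤ entK T k :=
  Finset.le_sup' (entS T) (by simpa using h)

/-- If `π` maps `S` to the nodes of `T` at most two-to-one, and does not make the trace of `S`
on a subtree smaller than the trace of its image, then `H_S` is at most
`2 H_{π(S)} + 2 |π(S)|`. -/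
theorem entS_le_two_mul_entS_image {α β : Type*} [DecidableEq α] (T : RTree α) (T' : RTree β)
    (S : Finset β) (π : β → α)
    (hfib : ∀ a ∈ S.image π, (S.filter fun b => π b = a).card ≤ 2)
    (hsub : ∀ b ∈ S, T.subtree (π b) ∩ ↑(S.image π) ⊆ π '' (T'.subtree b ∩ ↑S)) :
    entS T' S ≤ 2 * entS T (S.image π) + 2 * ((S.image π).card : ℝ) := by
  set U := S.image π with hU
  set u : α → ℝ := fun v => ((T.subtree v ∩ ↑U).ncard : ℝ) with hu
  have hUS : (U.card : ℝ) ≤ S.card := by exact_mod_cast Finset.card_image_le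
  have hSU : (S.card : ℝ) ≤ 2 * U.card := by
    exact_mod_cast Finset.card_le_mul_card_image S 2 hfib
  have hupos : ∀ v ∈ U, 0 < u v := fun v hv => Nat.cast_pos.2 (ncard_subtree_inter_pos T hv)
  have hule : ∀ v, u v ≤ U.card := fun v => Nat.cast_le.2 (ncard_subtree_inter_le T U v)
  have hnonneg : ∀ v ∈ U, 0 ≤ Real.logb 2 (S.card / u v) := fun v hv =>
    Real.logb_nonneg one_lt_two ((one_le_div (hupos v hv)).2 ((hule v).trans hUS))
  have hterm : ∀ v ∈ U,
      Real.logb 2 (S.card / u v) ≤ Real.logb 2 (U.card / u v) + 1 := fun v hv => by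
    have hv0 := hupos v hv
    have hU0 : (0 : ℝ) < U.card := hv0.trans_le (hule v)
    calc Real.logb 2 (S.card / u v) ≤ Real.logb 2 (U.card / u v * 2) := by
          apply Real.logb_le_logb_of_le one_lt_two
          · exact div_pos (hU0.trans_le hUS) hv0
          · rw [div_mul_eq_mul_div]
            gcongr
            linarith
      _ = Real.logb 2 (U.card / u v) + 1 := by
          rw [Real.logb_mul (div_pos hU0 hv0).ne' two_ne_zero,
            Real.logb_self_eq_one one_lt_two]
  calc entS T' S ≤ ∑ b ∈ S, Real.logb 2 (S.card / u (π b)) := by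
        refine Finset.sum_le_sum fun b hb => ?_
        have hb0 := hupos (π b) (Finset.mem_image_of_mem π hb)
        have hfin : (T'.subtree b ∩ ↑S).Finite := S.finite_toSet.subset Set.inter_subset_right
        have hle : u (π b) ≤ ((T'.subtree b ∩ ↑S).ncard : ℝ) := Nat.cast_le.2
          ((Set.ncard_le_ncard (hsub b hb) (hfin.image π)).trans (Set.ncard_image_le hfin))
        have hS0 : (0 : ℝ) < S.card := hb0.trans_le ((hule _).trans hUS)
        apply Real.logb_le_logb_of_le one_lt_two
        · exact div_pos hS0 (hb0.trans_le hle)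
        · gcongr
    _ = ∑ v ∈ U, ((S.filter fun b => π b = v).card : ℝ) * Real.logb 2 (S.card / u v) := by
        rw [Finset.sum_comp (fun v => Real.logb 2 (S.card / u v)) π]
        simp only [nsmul_eq_mul, hU]
    _ ≤ ∑ v ∈ U, 2 * (Real.logb 2 (U.card / u v) + 1) := by
        refine Finset.sum_le_sum fun v hv => ?_
        have hc : ((S.filter fun b => π b = v).card : ℝ) ≤ 2 := by exact_mod_cast hfib v hv
        exact (mul_le_mul_of_nonneg_right hc (hnonneg v hv)).trans
          (mul_le_mul_of_nonneg_left (hterm v hv) zero_le_two)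
    _ = 2 * entS T U + 2 * (U.card : ℝ) := by
        rw [← Finset.mul_sum, Finset.sum_add_distrib]
        simp [entS, hu, mul_add]

/-- Let `T'` be the rooted tree obtained from `T` by subdividing every edge: `f` embeds the
original nodes, and for every non-root node `v`, `g v` is the new node subdividing the edge
from `v` to its parent (so `T'` has `2n − 1` nodes when `T` has `n` nodes). Then for every
positive integer `k`, `H_k(T') ≤ 2·H_k(T) + 2k`. -/
theorem entK_subdivision_le {α β : Type*} [Fintype α] [Fintype β]
    (T : RTree α) (T' : RTree β) (f g : α → β)
    (hf_inj : Function.Injective f)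
    (hg_inj : Set.InjOn g {v : α | v ≠ T.root})
    (hfg : ∀ u v : α, v ≠ T.root → f u ≠ g v)
    (hsurj : ∀ b : β, (∃ a : α, b = f a) ∨ (∃ a : α, a ≠ T.root ∧ b = g a))
    (hroot : f T.root = T'.root)
    (hpf : ∀ v : α, v ≠ T.root → T'.parent (f v) = g v)
    (hpg : ∀ v : α, v ≠ T.root → T'.parent (g v) = f (T.parent v))
    (k : ℕ) (hk : 0 < k) :
    entK T' k ≤ 2 * entK T k + 2 * (k : ℝ) := by
  classical
  have hπ : ∀ b : β, ∃ a : α, b = f a ∨ (a ≠ T.root ∧ b = g a) := fun b => by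
    rcases hsurj b with ⟨a, h⟩ | ⟨a, h⟩
    exacts [⟨a, Or.inl h⟩, ⟨a, Or.inr h⟩]
  choose π hπ using hπ
  refine Finset.sup'_le _ _ fun S hS => ?_
  have hSk : S.card ≤ k := by simpa using hS
  have hUk : (S.image π).card ≤ k := Finset.card_image_le.trans hSk
  refine (entS_le_two_mul_entS_image T T' S π (fun a _ => ?_) fun b hb => ?_).trans ?_
  · refine (Finset.card_le_card (t := {f a, g a}) fun b hb => ?_).trans Finset.card_le_two
    obtain ⟨-, rfl⟩ := Finset.mem_filter.1 hb
    rcases hπ b with h | ⟨-, h⟩ <;> simp [← h]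
  · rintro a ⟨hanc, haU⟩
    obtain ⟨x, hx, rfl⟩ := Finset.mem_image.1 (Finset.mem_coe.1 haU)
    by_cases hne : π b = π x
    · exact ⟨b, ⟨T'.ancestor_refl b, hb⟩, hne⟩
    refine ⟨x, ⟨?_, hx⟩, rfl⟩
    have hbf : T'.ancestor b (f (π b)) := by
      rcases hπ b with h | ⟨hr, h⟩
      · rw [← h]
        exact T'.ancestor_refl b
      · have := T'.ancestor_parent (f (π b))
        rwa [hpf _ hr, ← h] at this
    refine T'.ancestor_trans hbf ?_
    rcases hπ x with h | ⟨hr, h⟩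
    · have hp := RTree.ancestor_subdivision hpf hpg hanc
      rwa [← h] at hp
    · have hp := RTree.ancestor_subdivision hpf hpg (T.ancestor_parent_of_ne hanc hne)
      rw [← hpg _ hr, ← h] at hp
      exact T'.ancestor_trans hp (T'.ancestor_parent x)
  · have hent := entS_le_entK T hUk
    have hcard : ((S.image π).card : ℝ) ≤ k := by exact_mod_cast hUk
    linarith
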